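/- Fix θ > 0 and let u_n(θ) be the smallest maximizer of k ↦ L_n(θ,k) on {1,…,n}, and u_n*(θ) = θ log n − θψ(θ) − 1/2. Then the set { n ∈ ℕ : u_n(θ) ≠ ⌊u_n*(θ) + 1/2⌋ } is infinite; that is, for infinitely many n the mode differs from the nearest integer to u_n*(θ). -/

import Mathlib

open Real Filter

/-- The Ewens probability mass function with parameter `θ`. -/
noncomputable def ewensPMF (n : ℕ) (θ : ℝ) (k : ℕ) : ℝ :=
  θ ^ k * ((ascPochhammer ℕ n).coeff k : ℝ) / (ascPochhammer ℝ n).eval θ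

/-- The digamma function `ψ(θ) = Γ′(θ)/Γ(θ)`, the derivative of `log ∘ Γ`. -/
noncomputable def digamma (θ : ℝ) : ℝ := deriv (fun x => Real.log (Real.Gamma x)) θ

/-- `u_n*(θ) = θ log n − θψ(θ) − 1/2`. -/
noncomputable def uStar (n : ℕ) (θ : ℝ) : ℝ := θ * Real.log n - θ * digamma θ - 1 / 2

/-- `u` is the smallest maximizer of `k ↦ L_n(θ,k)` on `{1,…,n}`. -/
def IsLeastMode (θ : ℝ) (n u : ℕ) : Prop :=
  u ∈ Finset.Icc 1 n ∧ (∀ k ∈ Finset.Icc 1 n, ewensPMF n θ k ≤ ewensPMF n θ u) ∧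
    ∀ v ∈ Finset.Icc 1 n, (∀ k ∈ Finset.Icc 1 n, ewensPMF n θ k ≤ ewensPMF n θ v) → u ≤ v

section BernoulliSum

open Polynomial

variable {ι : Type*}

/-- The probability that exactly `m` of independent events with probabilities `p i`, `i ∈ s`,
occur. -/
noncomputable def bernoulliSumPMF (p : ι → ℝ) (s : Finset ι) (m : ℕ) : ℝ :=
  (∏ i ∈ s, (C (1 - p i) + C (p i) * X)).coeff m

variable {p : ι → ℝ} {q σ K : ℝ}

lemma bernoulliSumPMF_zero (s : Finset ι) :
    bernoulliSumPMF p s 0 = ∏ i ∈ s, (1 - p i) := by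
  simp [bernoulliSumPMF, coeff_zero_eq_eval_zero, eval_prod]

variable [DecidableEq ι]

lemma bernoulliSumPMF_succ_of_mem {s : Finset ι} {i : ι} (hi : i ∈ s) (m : ℕ) :
    bernoulliSumPMF p s (m + 1) = (1 - p i) * bernoulliSumPMF p (s.erase i) (m + 1) +
      p i * bernoulliSumPMF p (s.erase i) m := by
  unfold bernoulliSumPMF
  rw [← Finset.mul_prod_erase s _ hi, add_mul, coeff_add, coeff_C_mul, mul_assoc, coeff_C_mul,
    coeff_X_mul]

lemma bernoulliSumPMF_zero_of_mem {s : Finset ι} {i : ι} (hi : i ∈ s) :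
    bernoulliSumPMF p s 0 = (1 - p i) * bernoulliSumPMF p (s.erase i) 0 := by
  rw [bernoulliSumPMF_zero, bernoulliSumPMF_zero, ← Finset.mul_prod_erase s _ hi]

lemma succ_mul_bernoulliSumPMF_succ (s : Finset ι) (m : ℕ) :
    ((m : ℝ) + 1) * bernoulliSumPMF p s (m + 1) =
      ∑ i ∈ s, p i * bernoulliSumPMF p (s.erase i) m := by
  unfold bernoulliSumPMF
  rw [mul_comm, ← coeff_derivative, derivative_prod_finset, finsetSum_coeff]
  refine Finset.sum_congr rfl fun i _ => ?_
  rw [derivative_add, derivative_C, zero_add, derivative_C_mul_X, coeff_mul_C, mul_comm]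

lemma bernoulliSumPMF_nonneg (h0 : ∀ i, 0 ≤ p i) (h1 : ∀ i, p i ≤ 1) (s : Finset ι) (m : ℕ) :
    0 ≤ bernoulliSumPMF p s m := by
  induction s using Finset.induction_on generalizing m with
  | empty =>
    simp only [bernoulliSumPMF, Finset.prod_empty, coeff_one]
    split_ifs <;> norm_num
  | insert i s hi ih =>
    have hmem := Finset.mem_insert_self i s
    have := h0 i
    have := sub_nonneg.2 (h1 i)
    cases m with
    | zero =>
      rw [bernoulliSumPMF_zero_of_mem hmem, Finset.erase_insert hi]
      exact mul_nonneg this (ih 0)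
    | succ m =>
      rw [bernoulliSumPMF_succ_of_mem hmem, Finset.erase_insert hi]
      have := ih m
      have := ih (m + 1)
      positivity

/-- The Stein-type recursion for the distribution of a sum of independent Bernoulli variables. -/
lemma bernoulliSumPMF_stein (s : Finset ι) (m : ℕ) :
    ((m : ℝ) + 2) * bernoulliSumPMF p s (m + 2) = (∑ i ∈ s, p i) * bernoulliSumPMF p s (m + 1) +
      ∑ i ∈ s, p i ^ 2 *
        (bernoulliSumPMF p (s.erase i) (m + 1) - bernoulliSumPMF p (s.erase i) m) := by
  have h := succ_mul_bernoulliSumPMF_succ (p := p) s (m + 1)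
  push_cast at h
  rw [show (m : ℝ) + 2 = m + 1 + 1 by ring, h, Finset.sum_mul, ← Finset.sum_add_distrib]
  refine Finset.sum_congr rfl fun i hi => ?_
  rw [bernoulliSumPMF_succ_of_mem hi]
  ring

lemma sum_mul_bernoulliSumPMF_zero_le (h0 : ∀ i, 0 ≤ p i) (h1 : ∀ i, p i ≤ 1) (s : Finset ι) :
    (∑ i ∈ s, p i) * bernoulliSumPMF p s 0 ≤ bernoulliSumPMF p s 1 := by
  have h := succ_mul_bernoulliSumPMF_succ (p := p) s 0
  simp only [Nat.cast_zero, zero_add, one_mul] at h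
  rw [h, Finset.sum_mul]
  refine Finset.sum_le_sum fun i hi => mul_le_mul_of_nonneg_left ?_ (h0 i)
  rw [bernoulliSumPMF_zero_of_mem hi]
  have := bernoulliSumPMF_nonneg h0 h1 (s.erase i) 0
  nlinarith [h0 i]

lemma mul_bernoulliSumPMF_erase_le (h0 : ∀ i, 0 ≤ p i) (hq : ∀ i, p i ≤ q) (hq1 : q < 1)
    {s : Finset ι} {i : ι} (hi : i ∈ s) (m : ℕ) :
    (1 - q) * bernoulliSumPMF p (s.erase i) m ≤ bernoulliSumPMF p s m := by
  have h1 : ∀ i, p i ≤ 1 := fun i => (hq i).trans hq1.le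
  have hn := bernoulliSumPMF_nonneg h0 h1 (s.erase i)
  have hle := mul_le_mul_of_nonneg_right (sub_le_sub_left (hq i) 1) (hn m)
  cases m with
  | zero => rwa [bernoulliSumPMF_zero_of_mem hi]
  | succ m =>
    rw [bernoulliSumPMF_succ_of_mem hi]
    linarith [mul_nonneg (h0 i) (hn m)]

lemma mul_sum_sq_mul_bernoulliSumPMF_erase_le (h0 : ∀ i, 0 ≤ p i) (hq : ∀ i, p i ≤ q)
    (hq1 : q < 1) {s : Finset ι} (hσ : ∑ i ∈ s, p i ^ 2 ≤ σ) (hK : 4 * σ ≤ K * (1 - q)) (m : ℕ) :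
    4 * ∑ i ∈ s, p i ^ 2 * bernoulliSumPMF p (s.erase i) m ≤ K * bernoulliSumPMF p s m := by
  have h1 : ∀ i, p i ≤ 1 := fun i => (hq i).trans hq1.le
  have hn := bernoulliSumPMF_nonneg h0 h1 s m
  have hc : 0 < 1 - q := sub_pos.2 hq1
  have hsum : (1 - q) * ∑ i ∈ s, p i ^ 2 * bernoulliSumPMF p (s.erase i) m ≤
      σ * bernoulliSumPMF p s m := by
    refine le_trans ?_ (mul_le_mul_of_nonneg_right hσ hn)
    rw [Finset.mul_sum, Finset.sum_mul]
    refine Finset.sum_le_sum fun i hi => ?_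
    have := mul_le_mul_of_nonneg_left (mul_bernoulliSumPMF_erase_le h0 hq hq1 hi m)
      (sq_nonneg (p i))
    linarith
  refine le_of_mul_le_mul_left ?_ hc
  have := mul_le_mul_of_nonneg_right hK hn
  linarith

lemma sum_mul_bernoulliSumPMF_le (h0 : ∀ i, 0 ≤ p i) (hq : ∀ i, p i ≤ q) (hq1 : q < 1)
    {s : Finset ι} (hσ : ∑ i ∈ s, p i ^ 2 ≤ σ) (hK : 4 * σ ≤ K * (1 - q))
    (hμ : 0 < ∑ i ∈ s, p i) (hKμ : 2 * K ≤ ∑ i ∈ s, p i) (m : ℕ)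
    (hm : (m : ℝ) + 1 ≤ 2 * ∑ i ∈ s, p i) :
    (∑ i ∈ s, p i) * bernoulliSumPMF p s m ≤ 2 * (m + 1) * bernoulliSumPMF p s (m + 1) := by
  have h1 : ∀ i, p i ≤ 1 := fun i => (hq i).trans hq1.le
  have hn := bernoulliSumPMF_nonneg h0 h1
  set μ := ∑ i ∈ s, p i with hμdef
  induction m with
  | zero =>
    have := sum_mul_bernoulliSumPMF_zero_le h0 h1 s
    simp only [Nat.cast_zero, zero_add]
    linarith [hn s 1]
  | succ m ih =>
    push_cast at hm ⊢
    have ih := ih (by linarith)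
    have hstep : bernoulliSumPMF p s m ≤ 4 * bernoulliSumPMF p s (m + 1) := by
      refine le_of_mul_le_mul_left ?_ hμ
      refine ih.trans ?_
      have := mul_le_mul_of_nonneg_right (show (m : ℝ) + 1 ≤ 2 * μ by linarith) (hn s (m + 1))
      linarith
    have hS := bernoulliSumPMF_stein (p := p) s m
    have hB := mul_sum_sq_mul_bernoulliSumPMF_erase_le h0 hq hq1 hσ hK m
    have hpos : 0 ≤ ∑ i ∈ s, p i ^ 2 * bernoulliSumPMF p (s.erase i) (m + 1) :=
      Finset.sum_nonneg fun i _ => mul_nonneg (sq_nonneg _) (hn _ _)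
    have hK0 : 0 ≤ K := by
      have : 0 ≤ σ := (Finset.sum_nonneg fun i _ => sq_nonneg (p i)).trans hσ
      exact nonneg_of_mul_nonneg_left (by linarith) (sub_pos.2 hq1)
    simp only [mul_sub, Finset.sum_sub_distrib] at hS
    have e1 := mul_le_mul_of_nonneg_left hstep hK0
    have e2 := mul_le_mul_of_nonneg_right hKμ (hn s (m + 1))
    rw [show m + 1 + 1 = m + 2 from rfl, show (m : ℝ) + 1 + 1 = m + 2 by ring]
    linarith

lemma bernoulliSumPMF_le_four_mul_succ (h0 : ∀ i, 0 ≤ p i) (hq : ∀ i, p i ≤ q) (hq1 : q < 1)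
    {s : Finset ι} (hσ : ∑ i ∈ s, p i ^ 2 ≤ σ) (hK : 4 * σ ≤ K * (1 - q))
    (hμ : 0 < ∑ i ∈ s, p i) (hKμ : 2 * K ≤ ∑ i ∈ s, p i) (m : ℕ)
    (hm : (m : ℝ) + 1 ≤ 2 * ∑ i ∈ s, p i) :
    bernoulliSumPMF p s m ≤ 4 * bernoulliSumPMF p s (m + 1) := by
  have hn := bernoulliSumPMF_nonneg h0 (fun i => (hq i).trans hq1.le) s (m + 1)
  refine le_of_mul_le_mul_left
    ((sum_mul_bernoulliSumPMF_le h0 hq hq1 hσ hK hμ hKμ m hm).trans ?_) hμ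
  linarith [mul_le_mul_of_nonneg_right hm hn]

lemma abs_bernoulliSumPMF_sub_le (h0 : ∀ i, 0 ≤ p i) (hq : ∀ i, p i ≤ q) (hq1 : q < 1)
    {s : Finset ι} (hσ : ∑ i ∈ s, p i ^ 2 ≤ σ) (hK : 4 * σ ≤ K * (1 - q))
    (hμ : 0 < ∑ i ∈ s, p i) (hKμ : 2 * K ≤ ∑ i ∈ s, p i) (m : ℕ)
    (hm : (m : ℝ) + 1 ≤ 2 * ∑ i ∈ s, p i) :
    |((m : ℝ) + 2) * bernoulliSumPMF p s (m + 2) - (∑ i ∈ s, p i) * bernoulliSumPMF p s (m + 1)| ≤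
      K * bernoulliSumPMF p s (m + 1) := by
  have h1 : ∀ i, p i ≤ 1 := fun i => (hq i).trans hq1.le
  have hn := bernoulliSumPMF_nonneg h0 h1
  have hstep := bernoulliSumPMF_le_four_mul_succ h0 hq hq1 hσ hK hμ hKμ m hm
  have hS := bernoulliSumPMF_stein (p := p) s m
  have hB := mul_sum_sq_mul_bernoulliSumPMF_erase_le h0 hq hq1 hσ hK m
  have hB' := mul_sum_sq_mul_bernoulliSumPMF_erase_le h0 hq hq1 hσ hK (m + 1)
  have hpos : ∀ k, 0 ≤ ∑ i ∈ s, p i ^ 2 * bernoulliSumPMF p (s.erase i) k := fun k =>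
    Finset.sum_nonneg fun i _ => mul_nonneg (sq_nonneg _) (hn _ _)
  have hK0 : 0 ≤ K := by
    have : 0 ≤ σ := (Finset.sum_nonneg fun i _ => sq_nonneg (p i)).trans hσ
    exact nonneg_of_mul_nonneg_left (by linarith) (sub_pos.2 hq1)
  simp only [mul_sub, Finset.sum_sub_distrib] at hS
  have e1 := mul_le_mul_of_nonneg_left hstep hK0
  have e3 := mul_nonneg hK0 (hn s (m + 1))
  rw [abs_le]
  constructor <;> linarith [hpos m, hpos (m + 1)]

lemma bernoulliSumPMF_pos (h0 : ∀ i, 0 ≤ p i) (hq : ∀ i, p i ≤ q) (hq1 : q < 1)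
    {s : Finset ι} (hσ : ∑ i ∈ s, p i ^ 2 ≤ σ) (hK : 4 * σ ≤ K * (1 - q))
    (hμ : 0 < ∑ i ∈ s, p i) (hKμ : 2 * K ≤ ∑ i ∈ s, p i) (m : ℕ)
    (hm : (m : ℝ) ≤ 2 * ∑ i ∈ s, p i) : 0 < bernoulliSumPMF p s m := by
  induction m with
  | zero =>
    rw [bernoulliSumPMF_zero]
    exact Finset.prod_pos fun i _ => by linarith [hq i]
  | succ m ih =>
    push_cast at hm
    have := sum_mul_bernoulliSumPMF_le h0 hq hq1 hσ hK hμ hKμ m hm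
    have := (mul_pos hμ (ih (by linarith))).trans_le this
    exact pos_of_mul_pos_right this (by positivity)

/-- Near the mean, consecutive values of the mass function of a Bernoulli sum agree up to a relative
error `O(1 / m)`. -/
lemma mul_abs_bernoulliSumPMF_succ_sub_le (h0 : ∀ i, 0 ≤ p i) (hq : ∀ i, p i ≤ q) (hq1 : q < 1)
    {s : Finset ι} (hσ : ∑ i ∈ s, p i ^ 2 ≤ σ) (hK : 4 * σ ≤ K * (1 - q)) (m : ℕ)
    (hμ : 0 < ∑ i ∈ s, p i) (hKμ : 2 * K ≤ ∑ i ∈ s, p i)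
    (hm : |∑ i ∈ s, p i - (m + 2)| ≤ 5) (hm' : (m : ℝ) + 1 ≤ 2 * ∑ i ∈ s, p i) :
    ((m : ℝ) + 2) * |bernoulliSumPMF p s (m + 2) - bernoulliSumPMF p s (m + 1)| ≤
      (5 + K) * bernoulliSumPMF p s (m + 1) := by
  have hn := bernoulliSumPMF_nonneg h0 (fun i => (hq i).trans hq1.le) s (m + 1)
  have h := abs_bernoulliSumPMF_sub_le h0 hq hq1 hσ hK hμ hKμ m hm'
  rw [← abs_of_nonneg (show (0 : ℝ) ≤ m + 2 by positivity), ← abs_mul]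
  have h2 := mul_le_mul_of_nonneg_right hm hn
  rw [← abs_of_nonneg hn, ← abs_mul, abs_of_nonneg hn] at h2
  calc _ = |(((m : ℝ) + 2) * bernoulliSumPMF p s (m + 2) -
          (∑ i ∈ s, p i) * bernoulliSumPMF p s (m + 1)) +
          (∑ i ∈ s, p i - (m + 2)) * bernoulliSumPMF p s (m + 1)| := by ring_nf
    _ ≤ _ := by
      refine (abs_add_le _ _).trans ?_
      linarith

/-- Below its mean by almost a unit, the mass function of a Bernoulli sum is increasing, at a
quantitative rate. -/
lemma mul_bernoulliSumPMF_le_mul_sub (h0 : ∀ i, 0 ≤ p i) (hq : ∀ i, p i ≤ q) (hq1 : q < 1)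
    (hσ : ∀ s : Finset ι, ∑ i ∈ s, p i ^ 2 ≤ σ) (hK : 4 * σ ≤ K * (1 - q)) (m : ℕ)
    (hm : 2 ≤ m) (hKm : 2 * K ≤ m) (hm' : 16 * σ * (5 + K) ≤ (1 - q) ^ 2 * (m + 2))
    {s : Finset ι} (hlow : 3 / 4 * (1 - q) ≤ ∑ i ∈ s, p i - (m + 3))
    (hup : ∑ i ∈ s, p i - (m + 3) ≤ 2) :
    (1 - q) / 2 * bernoulliSumPMF p s (m + 2) ≤
      (m + 3) * (bernoulliSumPMF p s (m + 3) - bernoulliSumPMF p s (m + 2)) := by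
  have hn := bernoulliSumPMF_nonneg h0 (fun i => (hq i).trans hq1.le)
  have hc : 0 < 1 - q := sub_pos.2 hq1
  have hσ0 : 0 ≤ σ := by simpa using hσ ∅
  have hK0 : 0 ≤ K := nonneg_of_mul_nonneg_left (by linarith) hc
  have hm2 : (2 : ℝ) ≤ m := by exact_mod_cast hm
  have hm0 : (0 : ℝ) < m + 2 := by positivity
  have h4 : bernoulliSumPMF p s (m + 1) ≤ 4 * bernoulliSumPMF p s (m + 2) :=
    bernoulliSumPMF_le_four_mul_succ h0 hq hq1 (hσ s) hK (by linarith) (by linarith) (m + 1)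
      (by push_cast; linarith)
  have hS := bernoulliSumPMF_stein (p := p) s (m + 1)
  push_cast at hS
  rw [show (m : ℝ) + 1 + 2 = m + 3 by ring, show m + 1 + 2 = m + 3 from rfl,
    show m + 1 + 1 = m + 2 from rfl] at hS
  have hsum : -((1 - q) / 4 * bernoulliSumPMF p s (m + 2)) ≤ ∑ i ∈ s, p i ^ 2 *
      (bernoulliSumPMF p (s.erase i) (m + 2) - bernoulliSumPMF p (s.erase i) (m + 1)) := by
    have hterm : ∀ i ∈ s, -(p i ^ 2 * ((5 + K) * bernoulliSumPMF p s (m + 1))) ≤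
        (1 - q) * (m + 2) * (p i ^ 2 *
          (bernoulliSumPMF p (s.erase i) (m + 2) - bernoulliSumPMF p (s.erase i) (m + 1))) := by
      intro i hi
      have hμi := Finset.sum_erase_eq_sub (f := p) hi
      have := h0 i
      have := hq i
      have hD := mul_abs_bernoulliSumPMF_succ_sub_le h0 hq hq1 (hσ (s.erase i)) hK m
        (by linarith) (by linarith) (by rw [abs_le]; constructor <;> linarith) (by linarith)
      have hE := mul_bernoulliSumPMF_erase_le h0 hq hq1 hi (m + 1)
      have h1 := mul_le_mul_of_nonneg_left hE (show 0 ≤ 5 + K by linarith)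
      have h2 := mul_le_mul_of_nonneg_left hD hc.le
      have h3 := mul_le_mul_of_nonneg_left
        (neg_abs_le (bernoulliSumPMF p (s.erase i) (m + 2) - bernoulliSumPMF p (s.erase i) (m + 1)))
        (mul_pos hc hm0).le
      have h5 := mul_le_mul_of_nonneg_left (show -((1 - q) * (m + 2) *
          (bernoulliSumPMF p (s.erase i) (m + 2) - bernoulliSumPMF p (s.erase i) (m + 1))) ≤
          (5 + K) * bernoulliSumPMF p s (m + 1) by linarith)
        (sq_nonneg (p i))
      linarith
    have hs := Finset.sum_le_sum hterm
    rw [← Finset.mul_sum, Finset.sum_neg_distrib, ← Finset.sum_mul] at hs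
    have e1 := mul_le_mul_of_nonneg_right (hσ s)
      (mul_nonneg (show 0 ≤ 5 + K by linarith) (hn s (m + 1)))
    have e2 := mul_le_mul_of_nonneg_left h4 (show 0 ≤ σ * (5 + K) by positivity)
    have e3 := mul_le_mul_of_nonneg_right hm' (hn s (m + 2))
    refine le_of_mul_le_mul_left ?_ (mul_pos hc hm0)
    linarith
  have := mul_le_mul_of_nonneg_right hlow (hn s (m + 2))
  linarith

/-- A Bernoulli sum whose mean is very close to the integer `m + 4` is more likely to equal
`m + 4` than `m + 3`. -/
theorem bernoulliSumPMF_lt_succ (h0 : ∀ i, 0 ≤ p i) (hq : ∀ i, p i ≤ q) (hq1 : q < 1)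
    (hσ : ∀ s : Finset ι, ∑ i ∈ s, p i ^ 2 ≤ σ) (hK : 4 * σ ≤ K * (1 - q)) (m : ℕ)
    (hm : 2 ≤ m) (hKm : 2 * K ≤ m) (hm' : 16 * σ * (5 + K) ≤ (1 - q) ^ 2 * (m + 2))
    {s : Finset ι} {i₀ : ι} (hi₀ : i₀ ∈ s)
    (hδ : |∑ i ∈ s, p i - (m + 4)| ≤ (1 - q) / 4)
    (hδ' : 2 * (3 + K) * (m + 3) * |∑ i ∈ s, p i - (m + 4)| < (1 - q) * p i₀ ^ 2) :
    bernoulliSumPMF p s (m + 3) < bernoulliSumPMF p s (m + 4) := by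
  have hn := bernoulliSumPMF_nonneg h0 (fun i => (hq i).trans hq1.le)
  have hc : 0 < 1 - q := sub_pos.2 hq1
  have hq0 : 0 ≤ q := (h0 i₀).trans (hq i₀)
  have hσ0 : 0 ≤ σ := by simpa using hσ ∅
  have hK0 : 0 ≤ K := nonneg_of_mul_nonneg_left (by linarith) hc
  have hm2 : (2 : ℝ) ≤ m := by exact_mod_cast hm
  have hm0 : (0 : ℝ) < m + 3 := by positivity
  have hδ2 := abs_le.1 hδ
  have hpos : 0 < bernoulliSumPMF p s (m + 3) :=
    bernoulliSumPMF_pos h0 hq hq1 (hσ s) hK (by linarith) (by linarith) (m + 3)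
      (by push_cast; linarith)
  have hS := bernoulliSumPMF_stein (p := p) s (m + 2)
  push_cast at hS
  rw [show (m : ℝ) + 2 + 2 = m + 4 by ring, show m + 2 + 2 = m + 4 from rfl,
    show m + 2 + 1 = m + 3 from rfl] at hS
  have hterm : ∀ i ∈ s, (1 - q) * bernoulliSumPMF p s (m + 3) ≤ 2 * (3 + K) * (m + 3) *
      (bernoulliSumPMF p (s.erase i) (m + 3) - bernoulliSumPMF p (s.erase i) (m + 2)) := by
    intro i hi
    have hμi := Finset.sum_erase_eq_sub (f := p) hi
    have := h0 i
    have := hq i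
    have hG := mul_bernoulliSumPMF_le_mul_sub h0 hq hq1 hσ hK m hm hKm hm' (s := s.erase i)
      (by linarith) (by linarith)
    have hU := (abs_le.1 (abs_bernoulliSumPMF_sub_le h0 hq hq1 (hσ (s.erase i)) hK
      (by linarith) (by linarith) (m + 1) (by push_cast; linarith))).2
    push_cast at hU
    rw [show (m : ℝ) + 1 + 2 = m + 3 by ring, show m + 1 + 2 = m + 3 from rfl,
      show m + 1 + 1 = m + 2 from rfl] at hU
    have hle : bernoulliSumPMF p s (m + 3) ≤
        (3 + K) * bernoulliSumPMF p (s.erase i) (m + 2) := by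
      have hn2 := hn (s.erase i) (m + 2)
      have h3 : bernoulliSumPMF p (s.erase i) (m + 3) ≤
          (2 + K) * bernoulliSumPMF p (s.erase i) (m + 2) := by
        refine le_of_mul_le_mul_left ?_ hm0
        have e1 := mul_le_mul_of_nonneg_right
          (show ∑ j ∈ s.erase i, p j ≤ 2 * (m + 3) by linarith) hn2
        have e2 := mul_nonneg (mul_nonneg hK0 hn2) (show (0 : ℝ) ≤ m + 2 by positivity)
        linarith
      rw [show m + 3 = m + 2 + 1 from rfl, bernoulliSumPMF_succ_of_mem hi,
        show m + 2 + 1 = m + 3 from rfl]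
      have e1 := mul_nonneg (h0 i) (hn (s.erase i) (m + 3))
      have e2 := mul_le_mul_of_nonneg_right (show p i ≤ 1 by linarith) hn2
      linarith
    have e1 := mul_le_mul_of_nonneg_left hle hc.le
    have e2 := mul_le_mul_of_nonneg_left hG (show 0 ≤ 2 * (3 + K) by linarith)
    linarith
  have hsum : (1 - q) * p i₀ ^ 2 * bernoulliSumPMF p s (m + 3) ≤
      2 * (3 + K) * (m + 3) * ∑ i ∈ s, p i ^ 2 *
        (bernoulliSumPMF p (s.erase i) (m + 3) - bernoulliSumPMF p (s.erase i) (m + 2)) := by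
    rw [Finset.mul_sum]
    refine le_trans ?_ (Finset.single_le_sum (fun i hi => ?_) hi₀)
    · linarith [mul_le_mul_of_nonneg_left (hterm i₀ hi₀) (sq_nonneg (p i₀))]
    · have e := (mul_nonneg hc.le hpos.le).trans (hterm i hi)
      linarith [mul_nonneg (sq_nonneg (p i)) e]
  have hA : 0 < 2 * (3 + K) * (m + 3) := by positivity
  have e1 := mul_lt_mul_of_pos_right hδ' hpos
  have e2 := mul_le_mul_of_nonneg_left (neg_abs_le (∑ i ∈ s, p i - (m + 4)))
    (mul_pos hA hpos).le
  have hfin : 0 < 2 * (3 + K) * (m + 3) * ((m + 4) *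
      (bernoulliSumPMF p s (m + 4) - bernoulliSumPMF p s (m + 3))) := by
    rw [mul_sub (m + 4 : ℝ), hS]
    linarith
  have := pos_of_mul_pos_right (pos_of_mul_pos_right hfin hA.le) (by positivity)
  linarith

end BernoulliSum

section Digamma

lemma hasDerivAt_log_Gamma {x : ℝ} (hx : 0 < x) :
    HasDerivAt (fun x => Real.log (Real.Gamma x)) (digamma x) x := by
  refine DifferentiableAt.hasDerivAt (DifferentiableAt.log ?_ (Real.Gamma_pos_of_pos hx).ne')
  refine Real.differentiableAt_Gamma fun m => ?_
  have : (0 : ℝ) ≤ m := m.cast_nonneg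
  linarith

lemma log_Gamma_add_one {x : ℝ} (hx : 0 < x) :
    Real.log (Real.Gamma (x + 1)) = Real.log x + Real.log (Real.Gamma x) := by
  rw [Real.Gamma_add_one hx.ne', Real.log_mul hx.ne' (Real.Gamma_pos_of_pos hx).ne']

lemma digamma_add_one {x : ℝ} (hx : 0 < x) : digamma (x + 1) = digamma x + 1 / x := by
  have h1 := (hasDerivAt_log_Gamma (add_pos hx one_pos)).comp_add_const x 1
  have h2 := (Real.hasDerivAt_log hx.ne').add (hasDerivAt_log_Gamma hx)
  have h3 := h2.congr_of_eventuallyEq (f₁ := fun x => Real.log (Real.Gamma (x + 1))) (by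
    filter_upwards [lt_mem_nhds hx] with y hy using log_Gamma_add_one hy)
  rw [h1.unique h3, one_div, add_comm]

lemma digamma_add_natCast {x : ℝ} (hx : 0 < x) (n : ℕ) :
    digamma (x + n) = digamma x + ∑ j ∈ Finset.range n, 1 / (x + j) := by
  induction n with
  | zero => simp
  | succ n ih =>
    rw [Finset.sum_range_succ, ← add_assoc, ← ih, Nat.cast_succ, ← add_assoc,
      digamma_add_one (by positivity)]

lemma digamma_le_log {x : ℝ} (hx : 0 < x) : digamma x ≤ Real.log x := by
  have h := Real.convexOn_log_Gamma.le_slope_of_hasDerivAt (Set.mem_Ioi.2 hx)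
    (Set.mem_Ioi.2 (add_pos hx one_pos)) (lt_add_one x) (hasDerivAt_log_Gamma hx)
  simpa [slope_def_field, log_Gamma_add_one hx] using h

lemma log_le_digamma_add_one {x : ℝ} (hx : 0 < x) : Real.log x ≤ digamma (x + 1) := by
  have h := Real.convexOn_log_Gamma.slope_le_of_hasDerivAt (Set.mem_Ioi.2 hx)
    (Set.mem_Ioi.2 (add_pos hx one_pos)) (lt_add_one x)
    (hasDerivAt_log_Gamma (add_pos hx one_pos))
  simpa [slope_def_field, log_Gamma_add_one hx] using h

lemma log_sub_log_le {x y : ℝ} (hx : 0 < x) (hy : 0 < y) :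
    Real.log y - Real.log x ≤ (y - x) / x := by
  rw [← Real.log_div hy.ne' hx.ne', sub_div, div_self hx.ne']
  exact Real.log_le_sub_one_of_pos (by positivity)

lemma abs_digamma_add_sub_log_le {θ x : ℝ} (hθ : 0 < θ) (hx : 0 < x) :
    |digamma (θ + x) - Real.log x| ≤ (θ + 1) / x := by
  have h1 := digamma_le_log (add_pos hθ hx)
  have h2 := log_le_digamma_add_one (add_pos hθ hx)
  have h3 := log_sub_log_le hx (add_pos hθ hx)
  rw [add_sub_cancel_right] at h3
  have h4 := Real.log_le_log hx (show x ≤ θ + x by linarith)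
  have h5 : 1 / (θ + x) ≤ 1 / x := one_div_le_one_div_of_le hx (by linarith)
  have h6 : 0 < θ / x := by positivity
  have h7 : 0 < 1 / x := by positivity
  rw [digamma_add_one (add_pos hθ hx)] at h2
  rw [add_div, abs_le]
  constructor <;> linarith

end Digamma

section Ewens

open Polynomial

/-- The success probabilities of the Bernoulli variables whose sum, shifted by one, has the Ewens
distribution. -/
noncomputable def ewensProb (θ : ℝ) (j : ℕ) : ℝ := θ / (θ + (j + 1))

lemma ascPochhammer_succ_eq_X_mul_prod (N : ℕ) :
    ascPochhammer ℝ (N + 1) = X * ∏ j ∈ Finset.range N, (X + C ((j : ℝ) + 1)) := by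
  induction N with
  | zero => simp
  | succ N ih =>
    rw [ascPochhammer_succ_right, ih, Finset.prod_range_succ, mul_assoc]
    simp

lemma ewensPMF_succ_succ {θ : ℝ} (hθ : 0 < θ) (N k : ℕ) :
    ewensPMF (N + 1) θ (k + 1) = bernoulliSumPMF (ewensProb θ) (Finset.range N) k := by
  have hprod : (∏ j ∈ Finset.range N, (X + C ((j : ℝ) + 1))).comp (C θ * X) =
      C (∏ j ∈ Finset.range N, (θ + ((j : ℝ) + 1))) *
        ∏ j ∈ Finset.range N, (C (1 - ewensProb θ j) + C (ewensProb θ j) * X) := by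
    rw [prod_comp, map_prod, ← Finset.prod_mul_distrib]
    refine Finset.prod_congr rfl fun j _ => ?_
    have hj : θ + ((j : ℝ) + 1) ≠ 0 := by positivity
    rw [mul_add, ← mul_assoc, ← C_mul, ← C_mul, mul_sub, ewensProb, mul_div_cancel₀ _ hj,
      add_comp, X_comp, C_comp, add_comm]
    congr 2
    ring
  have hcoeff : ((ascPochhammer ℕ (N + 1)).coeff (k + 1) : ℝ) =
      (∏ j ∈ Finset.range N, (X + C ((j : ℝ) + 1))).coeff k := by
    rw [← coeff_X_mul (∏ j ∈ _, _), ← ascPochhammer_succ_eq_X_mul_prod,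
      ← ascPochhammer_map (Nat.castRingHom ℝ), coeff_map, eq_natCast]
  have hc := congrArg (fun P => P.coeff k) hprod
  simp only [comp_C_mul_X_coeff, coeff_C_mul] at hc
  have hD : ∏ j ∈ Finset.range N, (θ + ((j : ℝ) + 1)) ≠ 0 :=
    Finset.prod_ne_zero_iff.2 fun j _ => by positivity
  rw [ewensPMF, hcoeff, ascPochhammer_succ_eq_X_mul_prod, bernoulliSumPMF, eval_mul, eval_prod,
    div_eq_iff (by simpa using ⟨hθ.ne', hD⟩), pow_succ]
  simp only [eval_X, eval_add, eval_C]
  linear_combination θ * hc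

lemma ewensProb_nonneg {θ : ℝ} (hθ : 0 < θ) (j : ℕ) : 0 ≤ ewensProb θ j := by
  unfold ewensProb; positivity

lemma ewensProb_le {θ : ℝ} (hθ : 0 < θ) (j : ℕ) : ewensProb θ j ≤ θ / (θ + 1) := by
  unfold ewensProb
  gcongr
  linarith [(Nat.cast_nonneg j : (0 : ℝ) ≤ j)]

lemma summable_ewensProb_sq {θ : ℝ} (hθ : 0 < θ) : Summable fun j => ewensProb θ j ^ 2 := by
  have h := ((summable_nat_add_iff 1).2
    (Real.summable_one_div_nat_pow.2 one_lt_two)).mul_left (θ ^ 2)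
  refine Summable.of_nonneg_of_le (fun j => sq_nonneg _) (fun j => ?_) h
  rw [ewensProb, div_pow, mul_one_div]
  push_cast
  exact div_le_div_of_nonneg_left (sq_nonneg θ) (by positivity)
    (pow_le_pow_left₀ (by positivity) (by linarith) 2)

lemma sum_ewensProb {θ : ℝ} (hθ : 0 < θ) (N : ℕ) :
    ∑ j ∈ Finset.range N, ewensProb θ j =
      θ * (digamma (θ + (N + 1 : ℕ)) - digamma θ) - 1 := by
  rw [digamma_add_natCast hθ, Finset.sum_range_succ', add_sub_cancel_left, mul_add, Finset.mul_sum]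
  simp [ewensProb, mul_inv_cancel₀ hθ.ne', div_eq_mul_inv]

end Ewens

lemma eventually_mul_le_exp {θ : ℝ} (hθ : 0 < θ) (c A : ℝ) :
    ∀ᶠ m : ℕ in atTop, A * (m + 5) + 1 ≤ Real.exp ((m + 5) / θ + c) := by
  have hlim : Tendsto (fun m : ℕ => (m : ℝ) + 5) atTop atTop :=
    tendsto_atTop_add_const_right _ _ tendsto_natCast_atTop_atTop
  have hB : 0 < Real.exp c / (2 * θ ^ 2) := by positivity
  filter_upwards [(hlim.const_mul_atTop hB).eventually_ge_atTop (A + 1)] with m hm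
  have hm0 : (0 : ℝ) ≤ m := m.cast_nonneg
  have h := Real.quadratic_le_exp_of_nonneg (show 0 ≤ ((m : ℝ) + 5) / θ by positivity)
  have h' : (((m : ℝ) + 5) / θ) ^ 2 / 2 ≤ Real.exp ((m + 5) / θ) := by
    have : 0 ≤ ((m : ℝ) + 5) / θ := by positivity
    linarith
  have h2 := mul_le_mul_of_nonneg_right hm (show (0 : ℝ) ≤ m + 5 by positivity)
  have h3 := mul_le_mul_of_nonneg_left h' (Real.exp_pos c).le
  rw [Real.exp_add, mul_comm (Real.exp _)]
  refine le_trans ?_ h3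
  refine le_trans (show _ ≤ (A + 1) * ((m : ℝ) + 5) by linarith) (h2.trans (le_of_eq ?_))
  field_simp

/-- For infinitely many `n` the mode differs from the nearest integer to `u_n*(θ)`. -/
theorem ewens_mode_not_nearest_integer_infinitely_often (θ : ℝ) (hθ : 0 < θ) (u : ℕ → ℕ)
    (hu : ∀ n ≥ 1, IsLeastMode θ n (u n)) :
    {n : ℕ | 1 ≤ n ∧ (u n : ℤ) ≠ ⌊uStar n θ + 1 / 2⌋}.Infinite := by
  set q := θ / (θ + 1) with hq
  set σ := ∑' j, ewensProb θ j ^ 2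
  set K := 4 * σ / (1 - q)
  have hq1 : q < 1 := by rw [hq, div_lt_one (by positivity)]; linarith
  have hc : 0 < 1 - q := sub_pos.2 hq1
  have hσ : ∀ s : Finset ℕ, ∑ i ∈ s, ewensProb θ i ^ 2 ≤ σ := fun s =>
    (summable_ewensProb_sq hθ).sum_le_tsum s fun i _ => sq_nonneg _
  have hσ0 : 0 ≤ σ := by simpa using hσ ∅
  have hK0 : 0 ≤ K := by positivity
  have hK : 4 * σ ≤ K * (1 - q) := (div_mul_cancel₀ _ hc.ne').ge
  have hp0 : 0 < ewensProb θ 0 := by unfold ewensProb; positivity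
  have hlarge : ∀ B : ℝ, ∀ᶠ m : ℕ in atTop, B ≤ m := fun B =>
    tendsto_natCast_atTop_atTop.eventually_ge_atTop B
  refine Set.infinite_of_forall_exists_gt fun B => ?_
  obtain ⟨m, hmB, hm2, hmK, hmσ, hE1, hEθ, hEδ, hEδ'⟩ := ((hlarge B).and <|
    (eventually_ge_atTop 2).and <| (hlarge (2 * K)).and <|
    (hlarge (16 * σ * (5 + K) / (1 - q) ^ 2)).and <|
    (eventually_mul_le_exp hθ (digamma θ) 1).and <|
    (eventually_mul_le_exp hθ (digamma θ) θ).and <|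
    (eventually_mul_le_exp hθ (digamma θ) (θ * (θ + 2) / ((1 - q) / 4))).and <|
    eventually_mul_le_exp hθ (digamma θ)
      (2 * (3 + K) * (θ * (θ + 2)) / ((1 - q) * ewensProb θ 0 ^ 2))).exists
  set E := Real.exp ((m + 5) / θ + digamma θ)
  have hm0 : (0 : ℝ) ≤ m := m.cast_nonneg
  obtain ⟨N, hN⟩ : ∃ N, ⌈E⌉₊ = N + 2 := by
    refine Nat.exists_eq_add_of_le' ?_
    have : (2 : ℝ) ≤ ⌈E⌉₊ := le_trans (by linarith) (Nat.le_ceil E)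
    exact_mod_cast this
  have hnE : ((N + 1 : ℕ) : ℝ) < E := Nat.lt_ceil.1 (by omega)
  have hEn : E ≤ ((N + 1 : ℕ) : ℝ) + 1 := by
    have := Nat.le_ceil E
    rw [hN] at this
    push_cast at this ⊢
    linarith
  have hn0 : (0 : ℝ) < (N + 1 : ℕ) := by positivity
  have hmn : (m : ℝ) + 5 ≤ (N + 1 : ℕ) := by linarith
  have hlogE : θ * (Real.log E - digamma θ) = m + 5 := by
    rw [Real.log_exp, add_sub_cancel_right, mul_div_cancel₀ _ hθ.ne']
  have hlog_lt := Real.log_lt_log hn0 hnE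
  have hlog_le : Real.log E - Real.log (N + 1 : ℕ) ≤ 1 / (N + 1 : ℕ) :=
    (log_sub_log_le hn0 (Real.exp_pos _)).trans
      (div_le_div_of_nonneg_right (by linarith) hn0.le)
  have hδ : |∑ i ∈ Finset.range N, ewensProb θ i - (m + 4)| ≤ θ * (θ + 2) / (N + 1 : ℕ) := by
    have h1 := abs_digamma_add_sub_log_le hθ hn0
    have h2 : ∑ i ∈ Finset.range N, ewensProb θ i - (m + 4) = θ *
        ((digamma (θ + (N + 1 : ℕ)) - Real.log (N + 1 : ℕ)) -
          (Real.log E - Real.log (N + 1 : ℕ))) := by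
      rw [sum_ewensProb hθ]
      linear_combination hlogE
    rw [h2, abs_mul, abs_of_pos hθ, mul_div_assoc]
    refine mul_le_mul_of_nonneg_left ((abs_sub _ _).trans ?_) hθ.le
    rw [abs_of_pos (sub_pos.2 hlog_lt), show θ + 2 = θ + 1 + 1 by ring, add_div (θ + 1)]
    exact add_le_add h1 hlog_le
  have hlt : bernoulliSumPMF (ewensProb θ) (Finset.range N) (m + 3) <
      bernoulliSumPMF (ewensProb θ) (Finset.range N) (m + 4) := by
    have hN0 : 0 ∈ Finset.range N := by
      have : m + 5 ≤ N + 1 := by exact_mod_cast hmn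
      exact Finset.mem_range.2 (by omega)
    refine bernoulliSumPMF_lt_succ (ewensProb_nonneg hθ) (ewensProb_le hθ) hq1 hσ hK m hm2 hmK ?_
      hN0 (hδ.trans ?_) ?_
    · rw [div_le_iff₀ (by positivity)] at hmσ
      linarith [sq_nonneg (1 - q)]
    · rw [div_le_comm₀ hn0 (by positivity)]
      have : 0 ≤ θ * (θ + 2) / ((1 - q) / 4) := by positivity
      nlinarith
    · refine (mul_le_mul_of_nonneg_left hδ (by positivity)).trans_lt ?_
      have hA : 0 < 2 * (3 + K) * (θ * (θ + 2)) / ((1 - q) * ewensProb θ 0 ^ 2) := by positivity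
      have h1 : 2 * (3 + K) * (θ * (θ + 2)) / ((1 - q) * ewensProb θ 0 ^ 2) * (m + 3) <
          (N + 1 : ℕ) := by linarith
      rw [div_mul_eq_mul_div, div_lt_iff₀ (by positivity)] at h1
      rw [mul_div_assoc', div_lt_iff₀ hn0]
      linarith
  have hfloor : ⌊uStar (N + 1) θ + 1 / 2⌋ = ((m + 4 : ℕ) : ℤ) := by
    have h1 := mul_lt_mul_of_pos_left hlog_lt hθ
    have h2 := mul_le_mul_of_nonneg_left hlog_le hθ.le
    have h3 : θ * (1 / (N + 1 : ℕ)) ≤ 1 := by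
      rw [mul_one_div, div_le_one hn0]
      nlinarith
    rw [Int.floor_eq_iff, uStar]
    push_cast at h1 h2 h3 ⊢
    constructor <;> linarith
  have hmN : m + 5 ≤ N + 1 := by exact_mod_cast hmn
  have hBm : B ≤ m := by exact_mod_cast hmB
  refine ⟨N + 1, ⟨by omega, fun hu' => ?_⟩, by omega⟩
  rw [hfloor, Nat.cast_inj] at hu'
  have hmax := (hu (N + 1) (by omega)).2.1 (m + 5) (Finset.mem_Icc.2 ⟨by omega, hmN⟩)
  rw [hu', ewensPMF_succ_succ hθ N (m + 4), ewensPMF_succ_succ hθ N (m + 3)] at hmax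
  exact hmax.not_gt hlt
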